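/- Let (n_j) be a sequence in ℕ² with n_{j,1} + n_{j,2} → ∞ and (N_j) a sequence of positive integers, and for each j let P^{(N_j)}_{n_j} be a type II multiple orthogonal polynomial for the weights e^{−N_jV₁}, e^{−N_jV₂}. Suppose that the zero-counting measures μ(P^{(N_j)}_{n_j}) converge weakly, as j → ∞, to a compactly supported probability measure λ on ℝ. Then for every fixed v ∈ ℤ² such that n_j + v ∈ ℕ² for all large j, the zero-counting measures μ(P^{(N_j)}_{n_j+v}) also converge weakly to the same measure λ. -/

import Mathlib

open MeasureTheory Polynomial

/-- Type II multiple orthogonal polynomial for the weights `e^{-N V₁}`, `e^{-N V₂}`,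
where `V₁(x) = V(x) - a·x` and `V₂(x) = V(x) + a·x`. -/
def IsTypeIIMOP (V : Polynomial ℝ) (a : ℝ) (N : ℕ) (k₁ k₂ : ℕ) (P : Polynomial ℝ) : Prop :=
  P.Monic ∧ P.natDegree = k₁ + k₂ ∧
  (∀ l < k₁, ∫ x : ℝ, P.eval x * x ^ l * Real.exp (-(N : ℝ) * (V.eval x - a * x)) = 0) ∧
  (∀ l < k₂, ∫ x : ℝ, P.eval x * x ^ l * Real.exp (-(N : ℝ) * (V.eval x + a * x)) = 0)

/-- The normalized zero counting measure `μ(q) = (1/deg q) ∑_{q(w)=0} δ_w`, with zeros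
counted according to multiplicity. -/
noncomputable def zeroCountMeasure (q : Polynomial ℝ) : Measure ℝ :=
  ((q.natDegree : ENNReal))⁻¹ • (q.roots.map (fun r => Measure.dirac r)).sum

lemma tendsto_eval_cobounded_atTop {U : ℝ[X]} (hdeg : 0 < U.natDegree) (heven : Even U.natDegree)
    (hlead : 0 < U.leadingCoeff) :
    Filter.Tendsto (fun x => U.eval x) (Bornology.cobounded ℝ) Filter.atTop := by
  refine (U.isEquivalent_cobounded_leading_monomial).symm.tendsto_atTop ?_
  refine Filter.Tendsto.const_mul_atTop hlead ?_
  have h := (Filter.tendsto_pow_atTop hdeg.ne').comp (tendsto_norm_cobounded_atTop (E := ℝ))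
  refine h.congr fun x => ?_
  simp [heven.pow_abs]

lemma integrable_eval_mul_exp_neg_eval {U : ℝ[X]} (hdeg : 0 < U.natDegree)
    (heven : Even U.natDegree) (hlead : 0 < U.leadingCoeff) (q : ℝ[X]) :
    Integrable fun x : ℝ => q.eval x * Real.exp (-U.eval x) := by
  have hcont : Continuous fun x : ℝ => q.eval x * Real.exp (-U.eval x) := by fun_prop
  have hU := tendsto_eval_cobounded_atTop hdeg heven hlead
  set r : ℝ[X] := q * (1 + X ^ 2) with hr
  have hle : r.degree ≤ (U ^ r.natDegree).degree := by
    have hU0 : U ^ r.natDegree ≠ 0 := pow_ne_zero _ (ne_zero_of_natDegree_gt hdeg)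
    rw [degree_eq_natDegree hU0, natDegree_pow]
    exact degree_le_natDegree.trans (by exact_mod_cast Nat.le_mul_of_pos_right _ hdeg)
  have h1 : (fun x => r.eval x * Real.exp (-U.eval x)) =O[Bornology.cobounded ℝ]
      fun _ => (1 : ℝ) := by
    have h2 := (isBigO_cobounded_of_degree_le hle).mul
      (Asymptotics.isBigO_refl (fun x => Real.exp (-U.eval x)) (Bornology.cobounded ℝ))
    refine h2.trans ?_
    have h3 := (Real.tendsto_pow_mul_exp_neg_atTop_nhds_zero r.natDegree).comp hU
    simpa [Function.comp_def] using h3.isBigO_one ℝ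
  have h4 : (fun x => q.eval x * Real.exp (-U.eval x)) =O[Filter.cocompact ℝ]
      fun x => (1 + x ^ 2)⁻¹ := by
    rw [← Metric.cobounded_eq_cocompact]
    have h5 := h1.mul
      (Asymptotics.isBigO_refl (fun x : ℝ => (1 + x ^ 2)⁻¹) (Bornology.cobounded ℝ))
    refine (h5.congr_left fun x => ?_).congr_right fun x => one_mul _
    have : (1 + x ^ 2 : ℝ) ≠ 0 := by positivity
    simp only [hr, eval_mul, eval_add, eval_one, eval_pow, eval_X]
    field_simp
  exact hcont.locallyIntegrable.integrable_of_isBigO_cocompact h4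
    (integrable_inv_one_add_sq.integrableAtFilter _)

lemma exists_strictMono_between {n : ℕ} {e : Fin (n + 1) → ℝ} (he : StrictMono e) {p : ℝ → Prop}
    (h : ∀ i : Fin n, ∃ y ∈ Set.Ioo (e i.castSucc) (e i.succ), p y) :
    ∃ y : Fin n → ℝ, StrictMono y ∧ (∀ i, y i ∈ Set.Ioo (e i.castSucc) (e i.succ)) ∧
      ∀ i, p (y i) := by
  choose y hy hp using h
  refine ⟨y, fun i j hij => ?_, hy, hp⟩
  have : e i.succ ≤ e j.castSucc := he.monotone (by simpa [Fin.le_def] using hij)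
  exact (hy i).2.trans_le (this.trans (hy j).1.le)

/-- Rolle's theorem for a finite set of zeros. -/
lemma exists_finset_zeros_deriv {f f' : ℝ → ℝ} (hf : ∀ x, HasDerivAt f (f' x) x) {s : Finset ℝ}
    (hs : ∀ x ∈ s, f x = 0) :
    ∃ t : Finset ℝ, s.card ≤ t.card + 1 ∧ Disjoint s t ∧ ∀ x ∈ t, f' x = 0 := by
  obtain h | ⟨n, hn⟩ : s.card = 0 ∨ ∃ n, s.card = n + 1 := by
    cases s.card <;> simp
  · exact ⟨∅, by simp [h]⟩
  let e := s.orderEmbOfFin hn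
  obtain ⟨y, hmono, hy, hzero⟩ := exists_strictMono_between (p := fun x => f' x = 0) e.strictMono
    fun i => exists_hasDerivAt_eq_zero (e.strictMono i.castSucc_lt_succ)
      (fun x _ => (hf x).continuousAt.continuousWithinAt)
      (by rw [hs _ (s.orderEmbOfFin_mem hn _), hs _ (s.orderEmbOfFin_mem hn _)])
      (fun x _ => hf x)
  refine ⟨Finset.univ.map ⟨y, hmono.injective⟩, by simp [hn], ?_, by simpa using hzero⟩
  rw [Finset.disjoint_left]
  intro x hx hx'
  obtain ⟨i, -, hi⟩ := Finset.mem_map.1 hx'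
  obtain ⟨j, hj⟩ : x ∈ Set.range e := by rw [s.range_orderEmbOfFin hn]; exact hx
  simp only [Function.Embedding.coeFn_mk] at hi
  have h1 := (hy i).1
  have h2 := (hy i).2
  rw [hi, ← hj] at h1 h2
  have h1 := e.lt_iff_lt.1 h1
  have h2 := e.lt_iff_lt.1 h2
  simp only [Fin.lt_def, Fin.val_castSucc, Fin.val_succ] at h1 h2
  omega

lemma hasDerivAt_expPoly (A B : ℝ[X]) (c x : ℝ) :
    HasDerivAt (fun y => A.eval y + B.eval y * Real.exp (c * y))
      ((derivative A).eval x + (derivative B + C c * B).eval x * Real.exp (c * x)) x := by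
  have h := ((hasDerivAt_id x).const_mul c).exp
  convert! (A.hasDerivAt x).add ((B.hasDerivAt x).mul h) using 1
  simp
  ring

lemma degree_derivative_lt_of_degree_lt_succ {A : ℝ[X]} {k : ℕ} (hA : A.degree < (k + 1 : ℕ)) :
    (derivative A).degree < k := by
  rcases eq_or_ne A 0 with rfl | h0
  · simp [bot_lt_iff_ne_bot]
  · exact (degree_derivative_lt h0).trans_le (degree_le_of_natDegree_le
      (Nat.lt_succ_iff.1 ((natDegree_lt_iff_degree_lt h0).2 hA)))

lemma degree_derivative_add_C_mul_lt {B : ℝ[X]} {k : ℕ} (c : ℝ) (hB : B.degree < k) :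
    (derivative B + C c * B).degree < k := by
  refine (degree_add_le _ _).trans_lt (max_lt ((degree_derivative_le).trans_lt hB) ?_)
  rw [← smul_eq_C_mul]
  exact (degree_smul_le c B).trans_lt hB

lemma eq_zero_of_derivative_add_C_mul_eq_zero {B : ℝ[X]} {c : ℝ} (hc : c ≠ 0)
    (h : derivative B + C c * B = 0) : B = 0 := by
  by_contra h0
  have h1 : (C c * B).degree = (derivative B).degree := by
    rw [eq_neg_of_add_eq_zero_right h, degree_neg]
  rw [degree_C_mul hc] at h1
  exact (degree_derivative_lt h0).ne h1.symm

lemma expPoly_eq_zero_of_derivative_eq_zero {A B : ℝ[X]} {c x : ℝ} (hc : c ≠ 0)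
    (hx : A.eval x + B.eval x * Real.exp (c * x) = 0)
    (h : derivative A = 0 ∧ derivative B + C c * B = 0) : A = 0 ∧ B = 0 := by
  have hB := eq_zero_of_derivative_add_C_mul_eq_zero hc h.2
  refine ⟨?_, hB⟩
  rw [eq_C_of_derivative_eq_zero h.1] at hx ⊢
  simpa [hB] using hx

/-- The functions `A(x) + B(x) e^{cx}` with `deg A < k₁`, `deg B < k₂` form a Chebyshev system. -/
lemma expPoly_eq_zero_of_card_le {c : ℝ} (hc : c ≠ 0) {k₁ k₂ : ℕ} {A B : ℝ[X]}
    (hA : A.degree < k₁) (hB : B.degree < k₂) {s : Finset ℝ} (hs : k₁ + k₂ ≤ s.card)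
    (h : ∀ x ∈ s, A.eval x + B.eval x * Real.exp (c * x) = 0) : A = 0 ∧ B = 0 := by
  induction k₁ generalizing A B s with
  | zero =>
    have hA0 : A = 0 := by simpa using hA
    refine ⟨hA0, eq_zero_of_degree_lt_of_eval_finset_eq_zero s
      (hB.trans_le (by exact_mod_cast (by omega : k₂ ≤ s.card))) fun x hx => ?_⟩
    simpa [hA0] using h x hx
  | succ k ih =>
    obtain ⟨t, ht, -, hzero⟩ := exists_finset_zeros_deriv (hasDerivAt_expPoly A B c) h
    obtain ⟨x, hx⟩ : s.Nonempty := Finset.card_pos.1 (by omega)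
    exact expPoly_eq_zero_of_derivative_eq_zero hc (h x hx)
      (ih (degree_derivative_lt_of_degree_lt_succ hA) (degree_derivative_add_C_mul_lt c hB)
        (by omega) hzero)

lemma expPoly_eq_zero_of_double_zero_of_succ {c : ℝ} (hc : c ≠ 0) {k₁ k₂ : ℕ} {A B : ℝ[X]}
    (hA : A.degree < (k₁ + 1 : ℕ)) (hB : B.degree < k₂) {s : Finset ℝ} (hs : k₁ + k₂ ≤ s.card)
    (h : ∀ x ∈ s, A.eval x + B.eval x * Real.exp (c * x) = 0) {x : ℝ} (hx : x ∈ s)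
    (hx' : (derivative A).eval x + (derivative B + C c * B).eval x * Real.exp (c * x) = 0) :
    A = 0 ∧ B = 0 := by
  obtain ⟨t, ht, hdisj, hzero⟩ := exists_finset_zeros_deriv (hasDerivAt_expPoly A B c) h
  have hxt : x ∉ t := Finset.disjoint_left.1 hdisj hx
  refine expPoly_eq_zero_of_derivative_eq_zero hc (h x hx)
    (expPoly_eq_zero_of_card_le hc (degree_derivative_lt_of_degree_lt_succ hA)
      (degree_derivative_add_C_mul_lt c hB) (s := insert x t) ?_ ?_)
  · rw [Finset.card_insert_of_notMem hxt]; omega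
  · simpa using ⟨by simpa using hx', by simpa using hzero⟩

lemma expPoly_eq_zero_of_double_zero {c : ℝ} (hc : c ≠ 0) {k₁ k₂ : ℕ} {A B : ℝ[X]}
    (hA : A.degree < k₁) (hB : B.degree < k₂) {s : Finset ℝ} (hs : k₁ + k₂ ≤ s.card + 1)
    (h : ∀ x ∈ s, A.eval x + B.eval x * Real.exp (c * x) = 0) {x : ℝ} (hx : x ∈ s)
    (hx' : (derivative A).eval x + (derivative B + C c * B).eval x * Real.exp (c * x) = 0) :
    A = 0 ∧ B = 0 := by
  rcases k₁ with _ | k₁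
  · rcases k₂ with _ | k₂
    · exact ⟨by simpa using hA, by simpa using hB⟩
    · have hA0 : A = 0 := by simpa using hA
      subst hA0
      have hexp := fun y => Real.exp_ne_zero (c * y)
      have hz : ∀ y ∈ s, B.eval y = 0 := by simpa [hexp] using h
      refine (expPoly_eq_zero_of_double_zero_of_succ (neg_ne_zero.2 hc) hB hA (s := s) (by omega)
        (by simpa using hz) hx ?_).symm
      simpa [hexp, hz x hx] using hx'
  · exact expPoly_eq_zero_of_double_zero_of_succ hc hA hB (by omega) h hx hx'

lemma exists_expPoly_vanishing (c : ℝ) {k₁ k₂ : ℕ} (s : Finset ℝ) (hs : s.card < k₁ + k₂) :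
    ∃ A B : ℝ[X], A.degree < k₁ ∧ B.degree < k₂ ∧ ¬(A = 0 ∧ B = 0) ∧
      ∀ x ∈ s, A.eval x + B.eval x * Real.exp (c * x) = 0 := by
  let T : degreeLT ℝ k₁ × degreeLT ℝ k₂ →ₗ[ℝ] s → ℝ :=
    { toFun := fun p x => (p.1 : ℝ[X]).eval x.1 + (p.2 : ℝ[X]).eval x.1 * Real.exp (c * x.1)
      map_add' := fun p q => by ext x; simp; ring
      map_smul' := fun r p => by ext x; simp; ring }
  have hfin : ∀ k, Module.finrank ℝ (degreeLT ℝ k) = k := fun k => by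
    rw [(degreeLTEquiv ℝ k).finrank_eq, Module.finrank_fin_fun]
  have : ∀ k, Module.Finite ℝ (degreeLT ℝ k) := fun k =>
    Module.Finite.equiv (degreeLTEquiv ℝ k).symm
  have hker : LinearMap.ker T ≠ ⊥ := LinearMap.ker_ne_bot_of_finrank_lt (by simp [hfin, hs])
  obtain ⟨⟨A, B⟩, hAB, hne⟩ := (Submodule.ne_bot_iff _).1 hker
  refine ⟨A, B, mem_degreeLT.1 A.2, mem_degreeLT.1 B.2, fun h => hne ?_, fun x hx =>
    congrFun (LinearMap.mem_ker.1 hAB) ⟨x, hx⟩⟩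
  ext1 <;> simp [Subtype.ext_iff, h]

lemma forall_pos_or_forall_neg {f : ℝ → ℝ} (hf : Continuous f) (h0 : ∀ x, f x ≠ 0) :
    (∀ x, 0 < f x) ∨ ∀ x, f x < 0 := by
  by_contra! h
  obtain ⟨⟨x, hx⟩, y, hy⟩ := h
  obtain ⟨z, hz⟩ := mem_range_of_exists_le_of_exists_ge hf ⟨x, hx⟩ ⟨y, hy⟩
  exact h0 z hz

/-- The quotient of two functions sharing their zeros, all simple, extends continuously. -/
lemma exists_continuous_mul_eq {f f' g g' : ℝ → ℝ} (hf : ∀ x, HasDerivAt f (f' x) x)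
    (hg : ∀ x, HasDerivAt g (g' x) x) (hfg : ∀ x, f x = 0 ↔ g x = 0)
    (hf' : ∀ x, f x = 0 → f' x ≠ 0) (hg' : ∀ x, g x = 0 → g' x ≠ 0) :
    ∃ G : ℝ → ℝ, Continuous G ∧ (∀ x, G x ≠ 0) ∧ ∀ x, f x = G x * g x := by
  classical
  refine ⟨fun x => if g x = 0 then f' x / g' x else f x / g x, ?_, fun x => ?_, fun x => ?_⟩
  · refine continuous_iff_continuousAt.2 fun x => ?_
    by_cases hx : g x = 0
    · have hfx := (hfg x).2 hx
      rw [← continuousWithinAt_compl_self, ContinuousWithinAt, if_pos hx]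
      refine (((hf x).tendsto_slope).div ((hg x).tendsto_slope) (hg' x hx)).congr' ?_
      filter_upwards [(hg x).eventually_ne (c := 0) (hg' x hx), self_mem_nhdsWithin] with y hy hyx
      have : y - x ≠ 0 := sub_ne_zero.2 hyx
      simp only [Pi.div_apply, if_neg hy, slope_def_field, hfx, hx, sub_zero]
      field_simp
    · refine ((hf x).continuousAt.div (hg x).continuousAt hx).congr ?_
      filter_upwards [(hg x).continuousAt.eventually_ne hx] with y hy
      simp [hy]
  · by_cases hx : g x = 0
    · simpa [hx] using ⟨hf' x ((hfg x).2 hx), hg' x hx⟩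
    · simpa [hx] using fun h => hx ((hfg x).1 h)
  · by_cases hx : g x = 0
    · simp [hx, (hfg x).2 hx]
    · simp [hx]

lemma eval_derivative_prod_X_sub_C_ne_zero (s : Finset ℝ) {x : ℝ} (hx : x ∈ s) :
    (derivative (∏ a ∈ s, (X - C a))).eval x ≠ 0 := by
  rw [← Finset.mul_prod_erase s _ hx, derivative_mul]
  simp only [derivative_X_sub_C, one_mul, eval_add, eval_mul, eval_sub, eval_X, eval_C, sub_self,
    zero_mul, add_zero, eval_prod]
  exact Finset.prod_ne_zero_iff.2 fun a ha => sub_ne_zero.2 (Finset.ne_of_mem_erase ha).symm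

/-- A function `A(x) + B(x) e^{cx}` that changes sign exactly at the points of `s`. -/
lemma exists_expPoly_eq_mul_prod {c : ℝ} (hc : c ≠ 0) {k₁ k₂ : ℕ} {s : Finset ℝ}
    (hs : s.card < k₁ + k₂) :
    ∃ A B : ℝ[X], A.degree < k₁ ∧ B.degree < k₂ ∧ ∃ G : ℝ → ℝ, (∀ x, 0 < G x) ∧
      ∀ x, A.eval x + B.eval x * Real.exp (c * x) = G x * ∏ a ∈ s, (x - a) := by
  obtain ⟨l₁, l₂, h₁, h₂, hl⟩ : ∃ l₁ l₂, l₁ ≤ k₁ ∧ l₂ ≤ k₂ ∧ l₁ + l₂ = s.card + 1 :=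
    ⟨min k₁ (s.card + 1), s.card + 1 - min k₁ (s.card + 1), by omega, by omega, by omega⟩
  obtain ⟨A, B, hA, hB, hne, hz⟩ := exists_expPoly_vanishing c (k₁ := l₁) (k₂ := l₂) s (by omega)
  have hg0 : ∀ x, (∏ a ∈ s, (X - C a) : ℝ[X]).eval x = 0 ↔ x ∈ s := fun x => by
    simp [eval_prod, Finset.prod_eq_zero_iff, sub_eq_zero]
  have hf0 : ∀ x, A.eval x + B.eval x * Real.exp (c * x) = 0 ↔ x ∈ s := fun x => by
    refine ⟨fun h => ?_, hz x⟩
    by_contra hx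
    exact hne (expPoly_eq_zero_of_card_le hc hA hB (s := insert x s)
      (by rw [Finset.card_insert_of_notMem hx]; omega) (by simpa using ⟨h, hz⟩))
  obtain ⟨G, hG, hG0, hfG⟩ := exists_continuous_mul_eq (hasDerivAt_expPoly A B c)
    (fun x => (∏ a ∈ s, (X - C a) : ℝ[X]).hasDerivAt x) (fun x => (hf0 x).trans (hg0 x).symm)
    (fun x hx h => hne (expPoly_eq_zero_of_double_zero hc hA hB hl.le hz ((hf0 x).1 hx) h))
    (fun x hx => eval_derivative_prod_X_sub_C_ne_zero s ((hg0 x).1 hx))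
  simp only [eval_prod, eval_sub, eval_X, eval_C] at hfG
  have h₁' : (l₁ : WithBot ℕ) ≤ k₁ := by exact_mod_cast h₁
  have h₂' : (l₂ : WithBot ℕ) ≤ k₂ := by exact_mod_cast h₂
  rcases forall_pos_or_forall_neg hG hG0 with h | h
  · exact ⟨A, B, hA.trans_le h₁', hB.trans_le h₂', G, h, hfG⟩
  · refine ⟨-A, -B, by simpa using hA.trans_le h₁', by simpa using hB.trans_le h₂', fun x => -G x,
      fun x => neg_pos.2 (h x), fun x => ?_⟩
    rw [neg_mul, ← hfG x]
    simp
    ring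

/-- The real zeros of odd multiplicity. -/
noncomputable def oddRoots (S : ℝ[X]) : Finset ℝ :=
  S.roots.toFinset.filter fun x => Odd (S.rootMultiplicity x)

lemma exists_sign_eval_mul_prod_oddRoots {S : ℝ[X]} (hS : S ≠ 0) :
    ∃ ε : ℝ, ε ≠ 0 ∧ ∀ x, 0 ≤ ε * (S.eval x * ∏ a ∈ oddRoots S, (x - a)) := by
  obtain ⟨q, hq, -, hroots⟩ := exists_prod_multiset_X_sub_C_mul S
  have hq0 : q ≠ 0 := by rintro rfl; simp_all
  have hqne : ∀ x, q.eval x ≠ 0 := fun x hx => by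
    have := (mem_roots hq0).2 hx
    simp [hroots] at this
  have hprod : ∀ x, 0 ≤ (S.roots.map fun a => X - C a).prod.eval x * ∏ a ∈ oddRoots S, (x - a) := by
    intro x
    rw [Finset.prod_multiset_map_count, oddRoots, Finset.prod_filter, eval_prod,
      ← Finset.prod_mul_distrib]
    refine Finset.prod_nonneg fun a _ => ?_
    rw [count_roots]
    simp only [eval_pow, eval_sub, eval_X, eval_C]
    split_ifs with h
    · rw [← pow_succ]
      exact (h.add_odd odd_one).pow_nonneg _
    · rw [mul_one]
      exact (Nat.not_odd_iff_even.1 h).pow_nonneg _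
  have key : ∀ ε x, ε * (S.eval x * ∏ a ∈ oddRoots S, (x - a)) = ε * q.eval x *
      ((S.roots.map fun a => X - C a).prod.eval x * ∏ a ∈ oddRoots S, (x - a)) := fun ε x => by
    nth_rw 1 [← hq]
    rw [eval_mul]
    ring
  rcases forall_pos_or_forall_neg q.continuous hqne with h | h
  · exact ⟨1, one_ne_zero, fun x => by
      rw [key]; exact mul_nonneg (by simpa using (h x).le) (hprod x)⟩
  · exact ⟨-1, by norm_num, fun x => by
      rw [key]; exact mul_nonneg (by simpa using (h x).le) (hprod x)⟩

/-- Two weights with ratio `e^{cx}`, `c ≠ 0`, all of whose moments are finite. -/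
structure ExpWeightPair (w₁ w₂ : ℝ → ℝ) (c : ℝ) : Prop where
  continuous_left : Continuous w₁
  pos_left : ∀ x, 0 < w₁ x
  right_eq : ∀ x, w₂ x = w₁ x * Real.exp (c * x)
  ne_zero : c ≠ 0
  integrable_left : ∀ q : ℝ[X], Integrable fun x => q.eval x * w₁ x
  integrable_right : ∀ q : ℝ[X], Integrable fun x => q.eval x * w₂ x

lemma ExpWeightPair.symm {w₁ w₂ : ℝ → ℝ} {c : ℝ} (h : ExpWeightPair w₁ w₂ c) :
    ExpWeightPair w₂ w₁ (-c) where
  continuous_left := by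
    rw [funext h.right_eq]
    exact h.continuous_left.mul (by fun_prop)
  pos_left x := by rw [h.right_eq]; exact mul_pos (h.pos_left x) (Real.exp_pos _)
  right_eq x := by rw [h.right_eq, mul_assoc, ← Real.exp_add]; simp
  ne_zero := neg_ne_zero.2 h.ne_zero
  integrable_left := h.integrable_right
  integrable_right := h.integrable_left

/-- The first `k` moments of `S` against the weight `w` vanish. -/
def MomentsVanish (w : ℝ → ℝ) (k : ℕ) (S : ℝ[X]) : Prop :=
  ∀ l < k, ∫ x : ℝ, S.eval x * x ^ l * w x = 0

lemma MomentsVanish.mono {w : ℝ → ℝ} {k l : ℕ} {S : ℝ[X]} (h : MomentsVanish w k S) (hl : l ≤ k) :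
    MomentsVanish w l S := fun i hi => h i (hi.trans_le hl)

lemma integral_linear_combination {w : ℝ → ℝ} (hw : ∀ q : ℝ[X], Integrable fun x => q.eval x * w x)
    (α β : ℝ) (S T : ℝ[X]) (l : ℕ) :
    ∫ x, (C α * S + C β * T).eval x * x ^ l * w x =
      α * (∫ x, S.eval x * x ^ l * w x) + β * ∫ x, T.eval x * x ^ l * w x := by
  have hint : ∀ S : ℝ[X], Integrable fun x => S.eval x * x ^ l * w x := fun S =>
    (hw (S * X ^ l)).congr (.of_forall fun x => by simp)
  rw [← integral_const_mul, ← integral_const_mul, ← integral_add ((hint S).const_mul α)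
    ((hint T).const_mul β)]
  refine integral_congr_ae (.of_forall fun x => ?_)
  simp
  ring

lemma MomentsVanish.linear_combination {w : ℝ → ℝ}
    (hw : ∀ q : ℝ[X], Integrable fun x => q.eval x * w x) {k : ℕ} {S T : ℝ[X]}
    (hS : MomentsVanish w k S) (hT : MomentsVanish w k T) (α β : ℝ) :
    MomentsVanish w k (C α * S + C β * T) := fun l hl => by
  rw [integral_linear_combination hw, hS l hl, hT l hl]
  simp

lemma MomentsVanish.integral_mul_eq_zero {w : ℝ → ℝ}
    (hw : ∀ q : ℝ[X], Integrable fun x => q.eval x * w x) {k : ℕ} {S A : ℝ[X]}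
    (hS : MomentsVanish w k S) (hA : A.degree < k) :
    ∫ x, S.eval x * A.eval x * w x = 0 := by
  rcases eq_or_ne A 0 with rfl | hA0
  · simp
  have hsum : ∀ x, S.eval x * A.eval x * w x =
      ∑ i ∈ Finset.range k, A.coeff i * (S.eval x * x ^ i * w x) := fun x => by
    rw [eval_eq_sum_range' ((natDegree_lt_iff_degree_lt hA0).2 hA), Finset.mul_sum, Finset.sum_mul]
    exact Finset.sum_congr rfl fun i _ => by ring
  simp_rw [hsum]
  rw [integral_finsetSum]
  · exact Finset.sum_eq_zero fun i hi => by
      rw [integral_const_mul, hS i (Finset.mem_range.1 hi), mul_zero]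
  · exact fun i _ => Integrable.const_mul ((hw (S * X ^ i)).congr (.of_forall fun x => by simp)) _

/-- A polynomial orthogonal to the multi-index `(k₁, k₂)` changes sign at least `k₁ + k₂` times. -/
lemma ExpWeightPair.le_card_oddRoots {w₁ w₂ : ℝ → ℝ} {c : ℝ} (hw : ExpWeightPair w₁ w₂ c)
    {k₁ k₂ : ℕ} {S : ℝ[X]} (hS : S ≠ 0) (h₁ : MomentsVanish w₁ k₁ S)
    (h₂ : MomentsVanish w₂ k₂ S) : k₁ + k₂ ≤ (oddRoots S).card := by
  by_contra! hlt
  obtain ⟨A, B, hA, hB, G, hG, hAB⟩ := exists_expPoly_eq_mul_prod hw.ne_zero hlt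
  obtain ⟨ε, hε, hsign⟩ := exists_sign_eval_mul_prod_oddRoots hS
  have hsplit : ∀ x, ε * (S.eval x * (A.eval x + B.eval x * Real.exp (c * x)) * w₁ x) =
      ε * (S.eval x * A.eval x * w₁ x + S.eval x * B.eval x * w₂ x) := fun x => by
    rw [hw.right_eq]; ring
  have hint₁ : Integrable fun x => S.eval x * A.eval x * w₁ x := by
    simpa using hw.integrable_left (S * A)
  have hint₂ : Integrable fun x => S.eval x * B.eval x * w₂ x := by
    simpa using hw.integrable_right (S * B)
  set f : ℝ → ℝ := fun x => ε * (S.eval x * (A.eval x + B.eval x * Real.exp (c * x)) * w₁ x)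
  have hint : Integrable f := by
    rw [show f = _ from funext hsplit]
    exact (hint₁.add hint₂).const_mul ε
  have hzero : ∫ x, f x = 0 := by
    rw [show f = _ from funext hsplit, integral_const_mul, integral_add hint₁ hint₂,
      h₁.integral_mul_eq_zero hw.integrable_left hA,
      h₂.integral_mul_eq_zero hw.integrable_right hB]
    simp
  have hnonneg : 0 ≤ f := fun x => by
    have : f x = G x * w₁ x * (ε * (S.eval x * ∏ a ∈ oddRoots S, (x - a))) := by
      simp only [f, hAB]; ring
    rw [this]
    exact mul_nonneg (mul_nonneg (hG x).le (hw.pos_left x).le) (hsign x)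
  have hcont : Continuous f := by
    have := hw.continuous_left
    fun_prop
  have hf0 : f = 0 := (Continuous.ae_eq_iff_eq volume hcont continuous_zero).1
    ((integral_eq_zero_iff_of_nonneg hnonneg hint).1 hzero)
  refine hS (eq_zero_of_infinite_isRoot S ((oddRoots S).finite_toSet.infinite_compl.mono ?_))
  intro x hx
  have hx0 : G x * ∏ a ∈ oddRoots S, (x - a) ≠ 0 := mul_ne_zero (hG x).ne'
    (Finset.prod_ne_zero_iff.2 fun a ha => sub_ne_zero.2 fun h => hx (by simpa [h] using ha))
  simpa [f, hAB, hε, hx0, (hw.pos_left x).ne'] using congrFun hf0 x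

lemma ExpWeightPair.rootMultiplicity_le_one {w₁ w₂ : ℝ → ℝ} {c : ℝ} (hw : ExpWeightPair w₁ w₂ c)
    {k₁ k₂ : ℕ} {S : ℝ[X]} (hS : S ≠ 0) (hdeg : S.natDegree ≤ k₁ + k₂ + 1)
    (h₁ : MomentsVanish w₁ k₁ S) (h₂ : MomentsVanish w₂ k₂ S) (x : ℝ) :
    S.rootMultiplicity x ≤ 1 := by
  by_contra! hx
  have hcard := hw.le_card_oddRoots hS h₁ h₂
  have hxr : x ∈ S.roots.toFinset := by
    rw [Multiset.mem_toFinset, ← Multiset.count_pos, count_roots]; omega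
  have hsum : ∑ a ∈ S.roots.toFinset, S.rootMultiplicity a ≤ S.natDegree := by
    simp_rw [← count_roots]
    rw [Multiset.toFinset_sum_count_eq]
    exact S.card_roots'
  have hodd : (oddRoots S).card =
      ∑ a ∈ S.roots.toFinset, if Odd (S.rootMultiplicity a) then 1 else 0 := by
    rw [oddRoots, Finset.card_filter]
  rw [← Finset.add_sum_erase _ _ hxr] at hsum hodd
  have hle : ∑ a ∈ S.roots.toFinset.erase x, (if Odd (S.rootMultiplicity a) then 1 else 0) ≤
      ∑ a ∈ S.roots.toFinset.erase x, S.rootMultiplicity a := by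
    refine Finset.sum_le_sum fun a _ => ?_
    split_ifs with h
    · exact h.pos
    · exact Nat.zero_le _
  split_ifs at hodd with h
  · obtain ⟨m, hm⟩ := h
    omega
  · omega

lemma ExpWeightPair.not_double_root {w₁ w₂ : ℝ → ℝ} {c : ℝ} (hw : ExpWeightPair w₁ w₂ c)
    {k₁ k₂ : ℕ} {S : ℝ[X]} (hS : S ≠ 0) (hdeg : S.natDegree ≤ k₁ + k₂ + 1)
    (h₁ : MomentsVanish w₁ k₁ S) (h₂ : MomentsVanish w₂ k₂ S) {x : ℝ} (hx : S.eval x = 0) :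
    (derivative S).eval x ≠ 0 := fun hx' =>
  (hw.rootMultiplicity_le_one hS hdeg h₁ h₂ x).not_gt
    ((one_lt_rootMultiplicity_iff_isRoot hS).2 ⟨hx, hx'⟩)

/-- Type II multiple orthogonal polynomials for a general pair of weights. -/
structure IsMOP (w₁ w₂ : ℝ → ℝ) (k₁ k₂ : ℕ) (P : ℝ[X]) : Prop where
  monic : P.Monic
  natDegree_eq : P.natDegree = k₁ + k₂
  left : MomentsVanish w₁ k₁ P
  right : MomentsVanish w₂ k₂ P

lemma IsMOP.symm {w₁ w₂ : ℝ → ℝ} {k₁ k₂ : ℕ} {P : ℝ[X]} (h : IsMOP w₁ w₂ k₁ k₂ P) :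
    IsMOP w₂ w₁ k₂ k₁ P := ⟨h.monic, h.natDegree_eq.trans (add_comm _ _), h.right, h.left⟩

lemma IsMOP.card_toFinset_roots {w₁ w₂ : ℝ → ℝ} {c : ℝ} (hw : ExpWeightPair w₁ w₂ c) {k₁ k₂ : ℕ}
    {P : ℝ[X]} (h : IsMOP w₁ w₂ k₁ k₂ P) : P.roots.toFinset.card = k₁ + k₂ := by
  refine le_antisymm ?_ ((hw.le_card_oddRoots h.monic.ne_zero h.left h.right).trans
    (Finset.card_filter_le _ _))
  exact (Multiset.toFinset_card_le _).trans (h.natDegree_eq ▸ P.card_roots')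

/-- If a polynomial has `natDegree` many distinct real zeros, these are all its roots. -/
lemma roots_eq_map_of_injective {P : ℝ[X]} (hP : P ≠ 0) {d : ℕ} (hdeg : P.natDegree ≤ d)
    {y : Fin d → ℝ} (hy : Function.Injective y) (hroot : ∀ i, P.eval (y i) = 0) :
    P.roots = Finset.univ.val.map y := by
  symm
  refine Multiset.eq_of_le_of_card_le ?_ (by simpa using P.card_roots'.trans hdeg)
  rw [Multiset.le_iff_subset ((Multiset.nodup_map_iff_of_injective hy).2 Finset.univ.nodup)]
  intro a ha
  obtain ⟨i, -, rfl⟩ := Multiset.mem_map.1 ha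
  exact (mem_roots hP).2 (hroot i)

lemma exists_isMOP {w₁ w₂ : ℝ → ℝ} {c : ℝ} (hw : ExpWeightPair w₁ w₂ c) (k₁ k₂ : ℕ) :
    ∃ P, IsMOP w₁ w₂ k₁ k₂ P := by
  have hlin : ∀ {w : ℝ → ℝ}, (∀ q : ℝ[X], Integrable fun x => q.eval x * w x) →
      ∀ l : ℕ, ∃ L : ℝ[X] →ₗ[ℝ] ℝ, ∀ q, L q = ∫ x, q.eval x * x ^ l * w x := fun {w} hw l =>
    ⟨{ toFun := fun q => ∫ x, q.eval x * x ^ l * w x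
       map_add' := fun q r => by
        simpa using integral_linear_combination hw 1 1 q r l
       map_smul' := fun s q => by
        simpa [smul_eq_C_mul] using integral_linear_combination hw s 0 q 0 l }, fun _ => rfl⟩
  choose L₁ hL₁ using hlin hw.integrable_left
  choose L₂ hL₂ using hlin hw.integrable_right
  let T : ℝ[X] →ₗ[ℝ] (Fin k₁ → ℝ) × (Fin k₂ → ℝ) :=
    (LinearMap.pi fun i : Fin k₁ => L₁ i).prod (LinearMap.pi fun i : Fin k₂ => L₂ i)
  have hT : ∀ q, T q = 0 → MomentsVanish w₁ k₁ q ∧ MomentsVanish w₂ k₂ q := fun q hq =>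
    ⟨fun l hl => by rw [← hL₁]; exact congrFun (congrArg Prod.fst hq) ⟨l, hl⟩,
      fun l hl => by rw [← hL₂]; exact congrFun (congrArg Prod.snd hq) ⟨l, hl⟩⟩
  have hfin : Module.finrank ℝ (degreeLT ℝ (k₁ + k₂)) = k₁ + k₂ := by
    rw [(degreeLTEquiv ℝ _).finrank_eq, Module.finrank_fin_fun]
  have : Module.Finite ℝ (degreeLT ℝ (k₁ + k₂)) := Module.Finite.equiv (degreeLTEquiv ℝ _).symm
  have hinj : Function.Injective (T.domRestrict (degreeLT ℝ (k₁ + k₂))) := by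
    rw [← LinearMap.ker_eq_bot, LinearMap.ker_eq_bot']
    intro q hq
    by_contra hne
    have hq0 : (q : ℝ[X]) ≠ 0 := by simpa using hne
    obtain ⟨h₁, h₂⟩ := hT q hq
    have hle := (hw.le_card_oddRoots hq0 h₁ h₂).trans ((Finset.card_filter_le _ _).trans
      ((Multiset.toFinset_card_le _).trans (card_roots' _)))
    exact hle.not_gt ((natDegree_lt_iff_degree_lt hq0).2 (mem_degreeLT.1 q.2))
  obtain ⟨q, hq⟩ := (LinearMap.injective_iff_surjective_of_finrank_eq_finrank
    (by simp [hfin])).1 hinj (T (X ^ (k₁ + k₂)))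
  have hqdeg := mem_degreeLT.1 q.2
  obtain ⟨h₁, h₂⟩ := hT (X ^ (k₁ + k₂) - (q : ℝ[X])) (by
    rw [map_sub, ← hq]; simp)
  refine ⟨X ^ (k₁ + k₂) - (q : ℝ[X]), monic_X_pow_sub hqdeg, ?_, h₁, h₂⟩
  rw [natDegree_eq_of_degree_eq (degree_sub_eq_left_of_degree_lt (by rwa [degree_X_pow])),
    natDegree_X_pow]

/-- Between consecutive zeros of `P_{k+e₁}` there is a zero of `P_k`. -/
lemma IsMOP.exists_root_between {w₁ w₂ : ℝ → ℝ} {c : ℝ} (hw : ExpWeightPair w₁ w₂ c) {k₁ k₂ : ℕ}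
    {P R : ℝ[X]} (hP : IsMOP w₁ w₂ k₁ k₂ P) (hR : IsMOP w₁ w₂ (k₁ + 1) k₂ R) {a b : ℝ}
    (hab : a < b) (ha : R.eval a = 0) (hb : R.eval b = 0) :
    ∃ y ∈ Set.Ioo a b, P.eval y = 0 := by
  have hwron : ∀ y, (derivative R).eval y * P.eval y - R.eval y * (derivative P).eval y ≠ 0 := by
    have hcomb : ∀ α β y, (α ≠ 0 ∨ β ≠ 0) → (C α * R + C β * P).eval y = 0 →
        (derivative (C α * R + C β * P)).eval y ≠ 0 := fun α β y hne => by
      refine hw.not_double_root (k₁ := k₁) (k₂ := k₂) (fun h0 => ?_) ?_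
        ((hR.left.mono (Nat.le_succ _)).linear_combination hw.integrable_left hP.left α β)
        (hR.right.linear_combination hw.integrable_right hP.right α β)
      · have hα : α = 0 := by
          have h := congrArg (fun p => p.coeff (k₁ + k₂ + 1)) h0
          have hR1 : R.coeff (k₁ + k₂ + 1) = 1 := by
            rw [show k₁ + k₂ + 1 = R.natDegree by rw [hR.natDegree_eq]; ring]
            exact hR.monic
          have hP1 : P.coeff (k₁ + k₂ + 1) = 0 :=
            coeff_eq_zero_of_natDegree_lt (by rw [hP.natDegree_eq]; omega)
          simpa [hR1, hP1] using h
        have hβ : β ≠ 0 := hne.resolve_left (not_not.2 hα)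
        simp [hα, hβ, hP.monic.ne_zero] at h0
      · refine (natDegree_add_le _ _).trans (max_le ?_ ?_)
        · refine (natDegree_C_mul_le _ _).trans ?_
          rw [hR.natDegree_eq]; omega
        · refine (natDegree_C_mul_le _ _).trans ?_
          rw [hP.natDegree_eq]; omega
    intro y hy
    by_cases hz : P.eval y = 0 ∧ R.eval y = 0
    · refine hcomb ((derivative P).eval y) (-(derivative R).eval y) y (.inl ?_) ?_ ?_
      · simpa using hcomb 0 1 y (.inr one_ne_zero) (by simp [hz.1])
      · simp [hz.1, hz.2]
      · simp
        ring
    · refine hcomb (P.eval y) (-R.eval y) y ?_ ?_ ?_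
      · rw [neg_ne_zero]
        tauto
      · simp
        ring
      · simp
        linarith
  by_contra! hne
  have hPne : ∀ y ∈ Set.Icc a b, P.eval y ≠ 0 := fun y hy h0 => by
    rcases eq_or_lt_of_le hy.1 with rfl | hay
    · exact hwron a (by simp [h0, ha])
    rcases eq_or_lt_of_le hy.2 with rfl | hyb
    · exact hwron y (by simp [h0, hb])
    exact hne y ⟨hay, hyb⟩ h0
  obtain ⟨y, hy, hy0⟩ := exists_hasDerivAt_eq_zero hab
    (R.continuous.continuousOn.div P.continuous.continuousOn hPne) (by simp [ha, hb])
    fun y hy => (R.hasDerivAt y).div (P.hasDerivAt y) (hne y hy)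
  refine hwron y ?_
  have := hne y hy
  field_simp at hy0
  simpa using hy0

/-- The sums of any monotone `[0, 1]`-valued function over the zeros of `P` and of `R`
differ by at most `t`. -/
def RootsClose (P R : ℝ[X]) (t : ℕ) : Prop :=
  ∀ g : ℝ → ℝ, Monotone g → (∀ x, g x ∈ Set.Icc 0 1) →
    |(P.roots.map g).sum - (R.roots.map g).sum| ≤ t

lemma RootsClose.symm {P R : ℝ[X]} {t : ℕ} (h : RootsClose P R t) : RootsClose R P t :=
  fun g hg hg' => by rw [abs_sub_comm]; exact h g hg hg'

lemma RootsClose.trans {P R S : ℝ[X]} {t u : ℕ} (h : RootsClose P R t) (h' : RootsClose R S u) :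
    RootsClose P S (t + u) := fun g hg hg' => by
  push_cast
  exact (abs_sub_le _ _ _).trans (add_le_add (h g hg hg') (h' g hg hg'))

lemma IsMOP.rootsClose_succ {w₁ w₂ : ℝ → ℝ} {c : ℝ} (hw : ExpWeightPair w₁ w₂ c) {k₁ k₂ : ℕ}
    {P R : ℝ[X]} (hP : IsMOP w₁ w₂ k₁ k₂ P) (hR : IsMOP w₁ w₂ (k₁ + 1) k₂ R) :
    RootsClose P R 1 := by
  have hcard : R.roots.toFinset.card = k₁ + k₂ + 1 := by
    rw [hR.card_toFinset_roots hw]; ring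
  let e := R.roots.toFinset.orderEmbOfFin hcard
  have he : ∀ i, R.eval (e i) = 0 := fun i => by
    have := R.roots.toFinset.orderEmbOfFin_mem hcard i
    exact (mem_roots hR.monic.ne_zero).1 (Multiset.mem_toFinset.1 this)
  obtain ⟨y, hmono, hy, hy0⟩ := exists_strictMono_between (p := fun x => P.eval x = 0) e.strictMono
    fun i => hP.exists_root_between hw hR (e.strictMono i.castSucc_lt_succ) (he _) (he _)
  intro g hg hg'
  rw [roots_eq_map_of_injective hP.monic.ne_zero hP.natDegree_eq.le hmono.injective hy0,
    roots_eq_map_of_injective hR.monic.ne_zero (by rw [hR.natDegree_eq]; omega) e.injective he,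
    Multiset.map_map, Multiset.map_map]
  change |∑ i, g (y i) - ∑ i, g (e i)| ≤ _
  have h1 : ∑ i, g (y i) ≤ ∑ i : Fin (k₁ + k₂), g (e i.succ) :=
    Finset.sum_le_sum fun i _ => hg (hy i).2.le
  have h2 : ∑ i : Fin (k₁ + k₂), g (e i.castSucc) ≤ ∑ i, g (y i) :=
    Finset.sum_le_sum fun i _ => hg (hy i).1.le
  have h3 := Fin.sum_univ_succ fun i => g (e i)
  have h4 := Fin.sum_univ_castSucc fun i => g (e i)
  have h5 := (hg' (e 0)).1
  have h6 := (hg' (e (Fin.last _))).2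
  rw [abs_le]
  constructor <;> push_cast <;> linarith

lemma rootsClose_refl (P : ℝ[X]) : RootsClose P P 0 := fun g _ _ => by simp

lemma IsMOP.unique {w₁ w₂ : ℝ → ℝ} {c : ℝ} (hw : ExpWeightPair w₁ w₂ c) {k₁ k₂ : ℕ}
    {P R : ℝ[X]} (hP : IsMOP w₁ w₂ k₁ k₂ P) (hR : IsMOP w₁ w₂ k₁ k₂ R) : P = R := by
  by_contra hne
  have hS : P - R ≠ 0 := sub_ne_zero.2 hne
  have hS' : P - R = C 1 * P + C (-1) * R := by simp [sub_eq_add_neg]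
  have hle := (hw.le_card_oddRoots hS
    (hS' ▸ hP.left.linear_combination hw.integrable_left hR.left 1 (-1))
    (hS' ▸ hP.right.linear_combination hw.integrable_right hR.right 1 (-1))).trans
    ((Finset.card_filter_le _ _).trans ((Multiset.toFinset_card_le _).trans (card_roots' _)))
  have hlt : (P - R).degree < P.degree := degree_sub_lt_left (by
    rw [degree_eq_natDegree hP.monic.ne_zero, degree_eq_natDegree hR.monic.ne_zero,
      hP.natDegree_eq, hR.natDegree_eq]) hP.monic.ne_zero
    (hP.monic.leadingCoeff.trans hR.monic.leadingCoeff.symm)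
  have := natDegree_lt_natDegree hS hlt
  rw [hP.natDegree_eq] at this
  omega

lemma IsMOP.rootsClose_add {w₁ w₂ : ℝ → ℝ} {c : ℝ} (hw : ExpWeightPair w₁ w₂ c) {k₁ k₂ : ℕ}
    (t : ℕ) {P R : ℝ[X]} (hP : IsMOP w₁ w₂ k₁ k₂ P) (hR : IsMOP w₁ w₂ (k₁ + t) k₂ R) :
    RootsClose P R t := by
  induction t generalizing R with
  | zero => exact hP.unique hw hR ▸ rootsClose_refl P
  | succ t ih =>
    obtain ⟨S, hS⟩ := exists_isMOP hw (k₁ + t) k₂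
    exact (ih hS).trans (hS.rootsClose_succ hw hR)

lemma IsMOP.rootsClose_left {w₁ w₂ : ℝ → ℝ} {c : ℝ} (hw : ExpWeightPair w₁ w₂ c) {k₁ l₁ k₂ : ℕ}
    {P R : ℝ[X]} (hP : IsMOP w₁ w₂ k₁ k₂ P) (hR : IsMOP w₁ w₂ l₁ k₂ R) :
    RootsClose P R ((l₁ : ℤ) - k₁).natAbs := by
  rcases le_total k₁ l₁ with h | h <;> obtain ⟨t, rfl⟩ := Nat.exists_eq_add_of_le h
  · simpa using hP.rootsClose_add hw t hR
  · simpa using (hR.rootsClose_add hw t hP).symm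

/-- Zeros of multiple orthogonal polynomials are stable under shifts of the multi-index. -/
lemma IsMOP.rootsClose {w₁ w₂ : ℝ → ℝ} {c : ℝ} (hw : ExpWeightPair w₁ w₂ c) {k₁ k₂ l₁ l₂ : ℕ}
    {P R : ℝ[X]} (hP : IsMOP w₁ w₂ k₁ k₂ P) (hR : IsMOP w₁ w₂ l₁ l₂ R) :
    RootsClose P R (((l₁ : ℤ) - k₁).natAbs + ((l₂ : ℤ) - k₂).natAbs) := by
  obtain ⟨S, hS⟩ := exists_isMOP hw l₁ k₂
  exact (hP.rootsClose_left hw hS).trans (hS.symm.rootsClose_left hw.symm hR.symm)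

/-- A compactly supported Lipschitz function is a difference of bounded monotone functions, so its
sums over the zeros of two polynomials with close zeros differ by a bounded amount. -/
lemma RootsClose.abs_sub_le_of_lipschitz {P Q : ℝ[X]} {t : ℕ} (hPQ : RootsClose P Q t)
    {h : ℝ → ℝ} {K R : ℝ} (hK : 0 ≤ K) (hR : 0 ≤ R) (hlip : ∀ x y, |h x - h y| ≤ K * |x - y|)
    (hsupp : ∀ x, R ≤ |x| → h x = 0) :
    |(P.roots.map h).sum - (Q.roots.map h).sum| ≤ 4 * (3 * K * R + 1) * t := by
  set M : ℝ := 3 * K * R + 1 with hM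
  have hKR : 0 ≤ K * R := mul_nonneg hK hR
  have hMpos : 0 < M := by rw [hM]; nlinarith
  set cl : ℝ → ℝ := fun x => max (-R) (min R x) with hcl
  have hclmono : Monotone cl := fun x y hxy => max_le_max le_rfl (min_le_min le_rfl hxy)
  have hclmem : ∀ x, -R ≤ cl x ∧ cl x ≤ R := fun x =>
    ⟨le_max_left _ _, max_le (by linarith) (min_le_left _ _)⟩
  have hhcl : ∀ x, h (cl x) = h x := fun x => by
    rcases le_or_gt R x with h1 | h1
    · have : cl x = R := by simp [hcl, h1, hR]
      rw [this, hsupp R (le_abs_self R), hsupp x (h1.trans (le_abs_self x))]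
    rcases le_or_gt x (-R) with h2 | h2
    · have : cl x = -R := by simp [hcl, h1.le, h2]
      rw [this, hsupp _ (by rw [abs_neg]; exact le_abs_self R),
        hsupp x (by rw [← abs_neg]; exact (by linarith : R ≤ -x).trans (le_abs_self _))]
    · have : cl x = x := by simp [hcl, h1.le, h2.le]
      rw [this]
  have hbound : ∀ x, |h x| ≤ 2 * (K * R) := fun x => by
    have h1 := hlip (cl x) R
    rw [hhcl, hsupp R (le_abs_self R), sub_zero] at h1
    refine h1.trans ?_
    have h2 : |cl x - R| ≤ 2 * R := by
      rw [abs_le]; constructor <;> linarith [hclmem x]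
    nlinarith [mul_le_mul_of_nonneg_left h2 hK]
  set g₁ : ℝ → ℝ := fun x => (K * cl x + h x + M) / (2 * M) with hg₁
  set g₂ : ℝ → ℝ := fun x => (K * cl x + M) / (2 * M) with hg₂
  have hclK : ∀ x, -(K * R) ≤ K * cl x ∧ K * cl x ≤ K * R := fun x =>
    ⟨by nlinarith [mul_le_mul_of_nonneg_left (hclmem x).1 hK],
      mul_le_mul_of_nonneg_left (hclmem x).2 hK⟩
  have hmono₁ : Monotone g₁ := fun x y hxy => by
    refine div_le_div_of_nonneg_right ?_ (by positivity)
    have h1 := (le_abs_self _).trans (hlip (cl x) (cl y))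
    rw [hhcl, hhcl, abs_sub_comm, abs_of_nonneg (sub_nonneg.2 (hclmono hxy))] at h1
    linarith
  have hmono₂ : Monotone g₂ := fun x y hxy => by
    refine div_le_div_of_nonneg_right ?_ (by positivity)
    linarith [mul_le_mul_of_nonneg_left (hclmono hxy) hK]
  have hmem₁ : ∀ x, g₁ x ∈ Set.Icc 0 1 := fun x => by
    have h1 := abs_le.1 (hbound x)
    have h2 := hclK x
    exact ⟨div_nonneg (by linarith) (by positivity), (div_le_one (by positivity)).2 (by linarith)⟩
  have hmem₂ : ∀ x, g₂ x ∈ Set.Icc 0 1 := fun x => by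
    have h2 := hclK x
    exact ⟨div_nonneg (by linarith) (by positivity), (div_le_one (by positivity)).2 (by linarith)⟩
  have hsum : ∀ s : Multiset ℝ,
      (s.map h).sum = 2 * M * ((s.map g₁).sum - (s.map g₂).sum) := fun s => by
    rw [← Multiset.sum_map_sub, ← Multiset.sum_map_mul_left]
    congr 1
    refine Multiset.map_congr rfl fun x _ => ?_
    simp only [hg₁, hg₂]
    field_simp
    ring
  rw [hsum, hsum, ← mul_sub, abs_mul, abs_of_pos (by positivity : 0 < 2 * M)]
  have h1 := abs_le.1 (hPQ g₁ hmono₁ hmem₁)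
  have h2 := abs_le.1 (hPQ g₂ hmono₂ hmem₂)
  have h3 : |(P.roots.map g₁).sum - (P.roots.map g₂).sum -
      ((Q.roots.map g₁).sum - (Q.roots.map g₂).sum)| ≤ 2 * t := by
    rw [abs_le]; constructor <;> linarith
  nlinarith [mul_le_mul_of_nonneg_left h3 (by positivity : 0 ≤ 2 * M)]

lemma integrable_and_integral_sum_dirac (f : ℝ → ℝ) (s : Multiset ℝ) :
    Integrable f (s.map fun r => Measure.dirac r).sum ∧
      ∫ x, f x ∂(s.map fun r => Measure.dirac r).sum = (s.map f).sum := by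
  induction s using Multiset.induction with
  | empty => simp
  | cons a s ih =>
    have ha : Integrable f (Measure.dirac a) := integrable_dirac (by simp)
    simp only [Multiset.map_cons, Multiset.sum_cons]
    exact ⟨ha.add_measure ih.1, by rw [integral_add_measure ha ih.1, ih.2, integral_dirac]⟩

lemma integral_zeroCountMeasure (f : ℝ → ℝ) (q : ℝ[X]) :
    ∫ x, f x ∂zeroCountMeasure q = (q.roots.map f).sum / q.natDegree := by
  rw [zeroCountMeasure, integral_smul_measure, (integrable_and_integral_sum_dirac f _).2]
  simp [div_eq_inv_mul]

lemma integrable_zeroCountMeasure (f : ℝ → ℝ) {q : ℝ[X]} (hq : q.natDegree ≠ 0) :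
    Integrable f (zeroCountMeasure q) :=
  (integrable_and_integral_sum_dirac f _).1.smul_measure (by simpa using hq)

lemma isProbabilityMeasure_zeroCountMeasure {q : ℝ[X]} (hq : q.natDegree ≠ 0)
    (hroots : q.roots.card = q.natDegree) : IsProbabilityMeasure (zeroCountMeasure q) := by
  have hs : ∀ s : Multiset ℝ, (s.map fun r => Measure.dirac r).sum Set.univ = s.card := fun s => by
    induction s using Multiset.induction with
    | empty => simp
    | cons a s ih => simp [ih, add_comm]
  constructor
  rw [zeroCountMeasure, Measure.smul_apply, hs, hroots, smul_eq_mul]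
  exact ENNReal.inv_mul_cancel (by simpa using hq) (by simp)

lemma tendsto_div_of_abs_sub_le {x y n : ℕ → ℝ} {C L : ℝ} (hn : Filter.Tendsto n .atTop .atTop)
    (hxy : ∀ᶠ j in .atTop, |x j - y j| ≤ C)
    (hy : Filter.Tendsto (fun j => y j / n j) .atTop (nhds L)) :
    Filter.Tendsto (fun j => x j / n j) .atTop (nhds L) := by
  have h0 : Filter.Tendsto (fun j => (x j - y j) / n j) .atTop (nhds 0) := by
    refine squeeze_zero_norm' ?_ ((tendsto_const_nhds (x := C)).div_atTop hn)
    filter_upwards [hxy, hn.eventually_gt_atTop 0] with j hj hnj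
    rw [Real.norm_eq_abs, abs_div, abs_of_pos hnj]
    exact div_le_div_of_nonneg_right hj hnj.le
  simpa [sub_div] using h0.add hy

lemma tendsto_integral_zeroCountMeasure_of_rootsClose {P Q : ℕ → ℝ[X]} {t : ℕ}
    (hdeg : Filter.Tendsto (fun j => (P j).natDegree) .atTop .atTop)
    (hP : ∀ᶠ j in .atTop, (P j).roots.card = (P j).natDegree)
    (hQ : ∀ᶠ j in .atTop, (Q j).roots.card = (Q j).natDegree)
    (hPQ : ∀ᶠ j in .atTop, RootsClose (P j) (Q j) t)
    {h : ℝ → ℝ} {K R L : ℝ} (hK : 0 ≤ K) (hR : 0 ≤ R) (hlip : ∀ x y, |h x - h y| ≤ K * |x - y|)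
    (hsupp : ∀ x, R ≤ |x| → h x = 0)
    (hL : Filter.Tendsto (fun j => ∫ x, h x ∂zeroCountMeasure (P j)) .atTop (nhds L)) :
    Filter.Tendsto (fun j => ∫ x, h x ∂zeroCountMeasure (Q j)) .atTop (nhds L) := by
  simp_rw [integral_zeroCountMeasure] at hL ⊢
  have hn : Filter.Tendsto (fun j => ((P j).natDegree : ℝ)) .atTop .atTop :=
    tendsto_natCast_atTop_atTop.comp hdeg
  have h1 := tendsto_div_of_abs_sub_le (x := fun j => ((Q j).roots.map h).sum) hn
    (hPQ.mono fun j hj => (abs_sub_comm _ _).trans_le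
      (hj.abs_sub_le_of_lipschitz hK hR hlip hsupp)) hL
  have h2 : Filter.Tendsto (fun j => ((Q j).natDegree : ℝ) / (P j).natDegree) .atTop (nhds 1) := by
    refine tendsto_div_of_abs_sub_le (y := fun j => ((P j).natDegree : ℝ)) (C := t) hn ?_ ?_
    · filter_upwards [hP, hQ, hPQ] with j hPj hQj hj
      have := hj (fun _ => 1) monotone_const (by simp)
      rw [abs_sub_comm]
      simpa [hPj, hQj] using this
    · refine tendsto_const_nhds.congr' ?_
      filter_upwards [hn.eventually_ne_atTop 0] with j hj
      rw [div_self hj]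
  have h3 := h1.div h2 one_ne_zero
  rw [div_one] at h3
  refine h3.congr' ?_
  filter_upwards [hn.eventually_ne_atTop 0] with j hj
  exact div_div_div_cancel_right₀ hj _ _

/-- The trapezoidal cutoff equal to `1` on `[-R, R]` and to `0` off `[-R - 1, R + 1]`. -/
noncomputable def cutoff (R x : ℝ) : ℝ := max 0 (min 1 (R + 1 - |x|))

lemma cutoff_nonneg (R x : ℝ) : 0 ≤ cutoff R x := le_max_left _ _

lemma cutoff_le_one (R x : ℝ) : cutoff R x ≤ 1 := max_le zero_le_one (min_le_left _ _)

lemma cutoff_eq_one {R x : ℝ} (h : |x| ≤ R) : cutoff R x = 1 := by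
  rw [cutoff, min_eq_left (by linarith), max_eq_right zero_le_one]

lemma cutoff_eq_zero {R x : ℝ} (h : R + 1 ≤ |x|) : cutoff R x = 0 :=
  max_eq_left ((min_le_right _ _).trans (by linarith))

lemma abs_cutoff_sub_le (R x y : ℝ) : |cutoff R x - cutoff R y| ≤ |x - y| := by
  refine (abs_max_sub_max_le_max _ _ _ _).trans (max_le (by simp) ?_)
  refine (abs_min_sub_min_le_max _ _ _ _).trans (max_le (by simp) ?_)
  rw [abs_sub_comm x y]
  refine le_trans (le_of_eq ?_) (abs_abs_sub_abs_le y x)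
  congr 1
  ring

lemma continuous_cutoff (R : ℝ) : Continuous (cutoff R) := by
  unfold cutoff
  fun_prop

lemma tendsto_integral_of_tendsto_compact {Q : ℕ → ℝ[X]}
    (hdeg : ∀ j, (Q j).natDegree ≠ 0) (hQ : ∀ j, (Q j).roots.card = (Q j).natDegree)
    {lam : Measure ℝ} [IsProbabilityMeasure lam] (hcpt : ∃ R : ℝ, lam {x : ℝ | R < |x|} = 0)
    (hconv : ∀ (h : ℝ → ℝ) (K R : ℝ), 0 ≤ K → 0 ≤ R → (∀ x y, |h x - h y| ≤ K * |x - y|) →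
      (∀ x, R ≤ |x| → h x = 0) →
      Filter.Tendsto (fun j => ∫ x, h x ∂zeroCountMeasure (Q j)) .atTop (nhds (∫ x, h x ∂lam)))
    (f : BoundedContinuousFunction ℝ ℝ) :
    Filter.Tendsto (fun j => ∫ x, f x ∂zeroCountMeasure (Q j)) .atTop (nhds (∫ x, f x ∂lam)) := by
  have hprob := fun j => isProbabilityMeasure_zeroCountMeasure (hdeg j) (hQ j)
  refine ProbabilityMeasure.tendsto_iff_forall_integral_tendsto
    (μs := fun j => ⟨zeroCountMeasure (Q j), hprob j⟩) (μ := ⟨lam, inferInstance⟩) |>.1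
    (tendsto_iff_forall_lipschitz_integral_tendsto.2 ?_) f
  rintro f ⟨C, hC⟩ ⟨L, hL⟩
  simp only [ProbabilityMeasure.coe_mk]
  obtain ⟨R₀, hR₀⟩ := hcpt
  set R := max R₀ 0
  have hR : 0 ≤ R := le_max_right _ _
  have hae : ∀ᵐ x ∂lam, cutoff R x = 1 := by
    filter_upwards [compl_mem_ae_iff.2 hR₀] with x hx
    exact cutoff_eq_one ((not_lt.1 (show ¬R₀ < |x| from hx)).trans (le_max_left _ _))
  set M := |f 0| + C
  have hM : ∀ x, |f x| ≤ M := fun x => by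
    have h1 := hC x 0
    rw [Real.dist_eq] at h1
    linarith [abs_sub_abs_le_abs_sub (f x) (f 0)]
  have hM0 : 0 ≤ M := (abs_nonneg _).trans (hM 0)
  have hχ := hconv (cutoff R) 1 (R + 1) zero_le_one (by linarith)
    (by simpa using abs_cutoff_sub_le R) (fun x hx => cutoff_eq_zero hx)
  have hfχ := hconv (fun x => f x * cutoff R x) (M + L) (R + 1) (by positivity) (by linarith)
    (fun x y => by
      have h1 : |f x - f y| ≤ L * |x - y| := by
        simpa [Real.dist_eq] using hL.dist_le_mul x y
      calc |f x * cutoff R x - f y * cutoff R y|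
          = |f x * (cutoff R x - cutoff R y) + (f x - f y) * cutoff R y| := by ring_nf
        _ ≤ |f x| * |cutoff R x - cutoff R y| + |f x - f y| * |cutoff R y| := by
          rw [← abs_mul, ← abs_mul]; exact abs_add_le _ _
        _ ≤ M * |x - y| + L * |x - y| * 1 := by
          refine add_le_add (mul_le_mul (hM x) (abs_cutoff_sub_le R x y) (abs_nonneg _) hM0)
            (mul_le_mul h1 ?_ (abs_nonneg _) (by positivity))
          rw [abs_of_nonneg (cutoff_nonneg R y)]
          exact cutoff_le_one R y
        _ = (M + L) * |x - y| := by ring) (fun x hx => by simp [cutoff_eq_zero hx])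
  rw [integral_congr_ae (hae.mono fun x hx => by simp only [hx] :
    cutoff R =ᵐ[lam] fun _ => (1 : ℝ))] at hχ
  rw [integral_congr_ae (hae.mono fun x hx => by simp [hx] :
    (fun x => f x * cutoff R x) =ᵐ[lam] f)] at hfχ
  simp only [integral_const, probReal_univ, smul_eq_mul, mul_one] at hχ
  have hdiff : Filter.Tendsto (fun j => ∫ x, f x ∂zeroCountMeasure (Q j) -
      ∫ x, f x * cutoff R x ∂zeroCountMeasure (Q j)) .atTop (nhds 0) := by
    have h0 : Filter.Tendsto (fun j => M * (1 - ∫ x, cutoff R x ∂zeroCountMeasure (Q j)))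
        .atTop (nhds 0) := by
      simpa using (hχ.const_sub 1).const_mul M
    refine squeeze_zero_norm (fun j => ?_) h0
    have hi := fun g : ℝ → ℝ => integrable_zeroCountMeasure g (hdeg j)
    have h1 : M * (1 - ∫ x, cutoff R x ∂zeroCountMeasure (Q j)) =
        ∫ x, M * (1 - cutoff R x) ∂zeroCountMeasure (Q j) := by
      rw [integral_const_mul, integral_sub (hi _) (hi _)]
      simp
    rw [h1, ← integral_sub (hi _) (hi _)]
    refine norm_integral_le_of_norm_le (hi _) (.of_forall fun x => ?_)
    have h2 : f x - f x * cutoff R x = f x * (1 - cutoff R x) := by ring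
    have h3 : 0 ≤ 1 - cutoff R x := sub_nonneg.2 (cutoff_le_one R x)
    rw [h2, Real.norm_eq_abs, abs_mul, abs_of_nonneg h3]
    exact mul_le_mul_of_nonneg_right (hM x) h3
  simpa using hdiff.add hfχ

lemma expWeightPair_of_even {V : ℝ[X]} (hVdeg : 2 ≤ V.natDegree) (hVeven : Even V.natDegree)
    (hVlead : 0 < V.leadingCoeff) {a : ℝ} (ha : 0 < a) {N : ℕ} (hN : 1 ≤ N) :
    ExpWeightPair (fun x => Real.exp (-(N : ℝ) * (V.eval x - a * x)))
      (fun x => Real.exp (-(N : ℝ) * (V.eval x + a * x))) (-(2 * N * a)) := by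
  have hN0 : (0 : ℝ) < N := by exact_mod_cast hN
  have hint : ∀ (b : ℝ) (q : ℝ[X]),
      Integrable fun x => q.eval x * Real.exp (-(N : ℝ) * (V.eval x + b * x)) := fun b q => by
    have hlt : (C b * X).degree < V.degree := by
      rw [degree_eq_natDegree (leadingCoeff_ne_zero.1 hVlead.ne')]
      exact (degree_C_mul_X_le b).trans_lt (by exact_mod_cast hVdeg)
    have hd : (C (N : ℝ) * (V + C b * X)).natDegree = V.natDegree := by
      rw [natDegree_C_mul hN0.ne', natDegree_add_eq_left_of_degree_lt hlt]
    refine (integrable_eval_mul_exp_neg_eval (U := C (N : ℝ) * (V + C b * X)) (by omega)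
      (by rwa [hd]) ?_ q).congr (.of_forall fun x => by simp)
    rw [leadingCoeff_mul, leadingCoeff_C, leadingCoeff_add_of_degree_lt' hlt]
    positivity
  refine ⟨by fun_prop, fun x => Real.exp_pos _, fun x => ?_, by simp; constructor <;> positivity,
    fun q => ?_, hint a⟩
  · rw [← Real.exp_add]
    ring_nf
  · simpa [sub_eq_add_neg] using hint (-a) q

lemma IsMOP.card_roots {w₁ w₂ : ℝ → ℝ} {c : ℝ} (hw : ExpWeightPair w₁ w₂ c) {k₁ k₂ : ℕ}
    {P : ℝ[X]} (h : IsMOP w₁ w₂ k₁ k₂ P) : P.roots.card = P.natDegree :=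
  le_antisymm P.card_roots' (by
    rw [h.natDegree_eq, ← h.card_toFinset_roots hw]; exact Multiset.toFinset_card_le _)

/-- **Stability of the limiting zero distribution under shifts of the multi-index.** -/
theorem stmt3 (V : Polynomial ℝ) (hVdeg : 2 ≤ V.natDegree) (hVeven : Even V.natDegree)
    (hVlead : 0 < V.leadingCoeff) (hV0 : V.coeff 0 = 0)
    (a : ℝ) (ha : 0 < a)
    (n : ℕ → ℕ × ℕ) (N : ℕ → ℕ) (hN : ∀ j, 1 ≤ N j)
    (hn : Filter.Tendsto (fun j => (n j).1 + (n j).2) Filter.atTop Filter.atTop)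
    (P : ℕ → Polynomial ℝ)
    (hP : ∀ j, IsTypeIIMOP V a (N j) (n j).1 (n j).2 (P j))
    (lam : Measure ℝ) (hprob : IsProbabilityMeasure lam)
    (hcpt : ∃ R : ℝ, lam {x : ℝ | R < |x|} = 0)
    (hconv : ∀ f : BoundedContinuousFunction ℝ ℝ,
      Filter.Tendsto (fun j => ∫ x, f x ∂(zeroCountMeasure (P j))) Filter.atTop
        (nhds (∫ x, f x ∂lam)))
    (v : ℤ × ℤ) (Q : ℕ → Polynomial ℝ)
    (hvQ : ∀ᶠ j in Filter.atTop,
      0 ≤ ((n j).1 : ℤ) + v.1 ∧ 0 ≤ ((n j).2 : ℤ) + v.2 ∧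
      IsTypeIIMOP V a (N j) (((n j).1 : ℤ) + v.1).toNat (((n j).2 : ℤ) + v.2).toNat (Q j)) :
    ∀ f : BoundedContinuousFunction ℝ ℝ,
      Filter.Tendsto (fun j => ∫ x, f x ∂(zeroCountMeasure (Q j))) Filter.atTop
        (nhds (∫ x, f x ∂lam)) := by
  have hw := fun j => expWeightPair_of_even hVdeg hVeven hVlead ha (hN j)
  have hPm : ∀ j, IsMOP (fun x => Real.exp (-(N j : ℝ) * (V.eval x - a * x)))
      (fun x => Real.exp (-(N j : ℝ) * (V.eval x + a * x))) (n j).1 (n j).2 (P j) := fun j =>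
    ⟨(hP j).1, (hP j).2.1, (hP j).2.2.1, (hP j).2.2.2⟩
  have hQm : ∀ᶠ j in Filter.atTop, (Q j).roots.card = (Q j).natDegree ∧
      RootsClose (P j) (Q j) (v.1.natAbs + v.2.natAbs) ∧
      (P j).natDegree ≤ (Q j).natDegree + (v.1.natAbs + v.2.natAbs) := by
    filter_upwards [hvQ] with j hj
    obtain ⟨h1, h2, hQ⟩ := hj
    have hQj : IsMOP (fun x => Real.exp (-(N j : ℝ) * (V.eval x - a * x)))
        (fun x => Real.exp (-(N j : ℝ) * (V.eval x + a * x))) _ _ (Q j) :=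
      ⟨hQ.1, hQ.2.1, hQ.2.2.1, hQ.2.2.2⟩
    refine ⟨hQj.card_roots (hw j), ?_, ?_⟩
    · have := (hPm j).rootsClose (hw j) hQj
      rwa [Int.toNat_of_nonneg h1, Int.toNat_of_nonneg h2, add_sub_cancel_left,
        add_sub_cancel_left] at this
    · rw [(hPm j).natDegree_eq, hQj.natDegree_eq]
      omega
  have hdegP : Filter.Tendsto (fun j => (P j).natDegree) Filter.atTop Filter.atTop :=
    hn.congr fun j => ((hPm j).natDegree_eq).symm
  obtain ⟨J, hJ⟩ := Filter.eventually_atTop.1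
    (hQm.and (hdegP.eventually_gt_atTop (v.1.natAbs + v.2.natAbs)))
  intro f
  rw [← Filter.tendsto_add_atTop_iff_nat J]
  refine tendsto_integral_of_tendsto_compact (Q := fun j => Q (j + J))
    (fun j => ?_) (fun j => (hJ _ (Nat.le_add_left _ _)).1.1) hcpt
    (fun h K R hK hR hlip hsupp => ?_) f
  · have := hJ _ (Nat.le_add_left J j)
    omega
  · refine (Filter.tendsto_add_atTop_iff_nat (f := fun j => ∫ x, h x ∂zeroCountMeasure (Q j)) J).2
      (tendsto_integral_zeroCountMeasure_of_rootsClose hdegP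
        (.of_forall fun j => (hPm j).card_roots (hw j)) (hQm.mono fun j hj => hj.1)
        (hQm.mono fun j hj => hj.2.1) hK hR hlip hsupp ?_)
    have hcont : Continuous h := (LipschitzWith.of_dist_le_mul (K := ⟨K, hK⟩) fun x y => by
      rw [Real.dist_eq, Real.dist_eq]; exact hlip x y).continuous
    obtain ⟨M, hM⟩ : ∃ M, ∀ x, ‖h x‖ ≤ M := hcont.bounded_above_of_compact_support
      (HasCompactSupport.intro (isCompact_Icc (a := -R) (b := R)) fun x hx => hsupp x (by
        by_contra! hlt
        exact hx ⟨(abs_lt.1 hlt).1.le, (abs_lt.1 hlt).2.le⟩))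
    exact hconv (BoundedContinuousFunction.ofNormedAddCommGroup h hcont M hM)
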